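/- arXiv:2202.01519 — 2 statements merged into one kernel-verified Lean document; each statement's English description precedes it below -/
import Mathlib

section
/- Let α and β be two independent uniformly random infinite binary sequences (i.i.d. Bernoulli(1/2)). There exists C > 0 such that for all k ≥ 1, the probability that both ∑_{j<k} α_j = ∑_{j<k} β_j and ∑_{j<k} j·α_j = ∑_{j<k} j·β_j is at most C·k^{−3/2}. Consequently, the expected number of k ≥ 1 for which both events hold is finite. -/
/-- The numerical value of the `j`-th letter of a word `α ∈ {0,1}^k`. -/
def bval {k : ℕ} (α : Fin k → Bool) (j : ℕ) : ℕ :=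
  if h : j < k then (if α ⟨j, h⟩ then 1 else 0) else 0

/-- The probability, for two independent uniformly random binary sequences
`α, β`, of the event `I_k` that `∑_{j<k} α_j = ∑_{j<k} β_j` and
`∑_{j<k} j·α_j = ∑_{j<k} j·β_j`.  Since `I_k` depends only on the first `k`
coordinates of each sequence, it equals the corresponding probability under
the uniform measure on pairs of words in `{0,1}^k`. -/
noncomputable def coincideProb (k : ℕ) : ℝ :=
  ((Finset.univ.filter fun p : (Fin k → Bool) × (Fin k → Bool) =>
      (∑ j ∈ Finset.range k, bval p.1 j = ∑ j ∈ Finset.range k, bval p.2 j) ∧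
      (∑ j ∈ Finset.range k, j * bval p.1 j =
        ∑ j ∈ Finset.range k, j * bval p.2 j)).card : ℝ) / (2 ^ k * 2 ^ k)

/-- The weighted sum of a word. -/
def wsum {k : ℕ} (a : Fin k → Bool) : ℕ := ∑ j : Fin k, (j : ℕ) * (if a j then 1 else 0)

lemma wsum_eq {k : ℕ} (a : Fin k → Bool) :
    ∑ j ∈ Finset.range k, j * bval a j = wsum a := by
  rw [Finset.sum_range]
  simp [wsum, bval]

lemma sum_exp_wsum (k : ℕ) (z : ℂ) :
    ∑ a : Fin k → Bool, Complex.exp ((wsum a : ℂ) * z) =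
      ∏ j ∈ Finset.range k, (1 + Complex.exp ((j : ℂ) * z)) := by
  rw [Finset.prod_range]
  have h := Finset.prod_univ_sum (fun _ : Fin k => (Finset.univ : Finset Bool))
    (fun j b => Complex.exp ((((j : ℕ) * (if b then 1 else 0) : ℕ) : ℂ) * z))
  rw [Fintype.piFinset_univ] at h
  have h2 : ∀ a : Fin k → Bool, Complex.exp ((wsum a : ℂ) * z) =
      ∏ j : Fin k, Complex.exp ((((j : ℕ) * (if a j then 1 else 0) : ℕ) : ℂ) * z) := by
    intro a
    rw [← Complex.exp_sum, ← Finset.sum_mul, wsum, Nat.cast_sum]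
  rw [Finset.sum_congr rfl (fun a _ => h2 a), ← h]
  refine Finset.prod_congr rfl fun j _ => ?_
  simp [add_comm]

lemma sum_cos (k : ℕ) (t : ℝ) :
    ∑ p : (Fin k → Bool) × (Fin k → Bool), Real.cos (((wsum p.1 : ℤ) - (wsum p.2 : ℤ) : ℤ) * t) =
      ∏ j ∈ Finset.range k, (2 + 2 * Real.cos (j * t)) := by
  have h1 := sum_exp_wsum k (t * Complex.I)
  have h2 := sum_exp_wsum k (-(t * Complex.I))
  have h3 : ∑ p : (Fin k → Bool) × (Fin k → Bool),
      Complex.exp (((((wsum p.1 : ℤ) - (wsum p.2 : ℤ) : ℤ) * t : ℝ) : ℂ) * Complex.I) =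
      ((∏ j ∈ Finset.range k, (2 + 2 * Real.cos (j * t)) : ℝ) : ℂ) := by
    have : ∀ p : (Fin k → Bool) × (Fin k → Bool),
      Complex.exp (((((wsum p.1 : ℤ) - (wsum p.2 : ℤ) : ℤ) * t : ℝ) : ℂ) * Complex.I) =
       Complex.exp ((wsum p.1 : ℂ) * (t * Complex.I)) * Complex.exp ((wsum p.2 : ℂ) * (-(t * Complex.I))) := by
      intro p
      rw [← Complex.exp_add]
      congr 1
      push_cast
      ring
    rw [Finset.sum_congr rfl (fun p _ => this p), Fintype.sum_prod_type]
    dsimp only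
    rw [← Finset.sum_mul_sum, h1, h2, ← Finset.prod_mul_distrib]
    push_cast
    refine Finset.prod_congr rfl fun j _ => ?_
    rw [Complex.cos, mul_neg]
    have : Complex.exp ((j : ℂ) * (t * Complex.I)) * Complex.exp (-((j : ℂ) * (t * Complex.I))) = 1 := by
      rw [← Complex.exp_add]; simp
    rw [show -((j : ℂ) * t) * Complex.I = -((j : ℂ) * (t * Complex.I)) by ring,
      show ((j : ℂ) * t) * Complex.I = ((j : ℂ) * (t * Complex.I)) by ring]
    linear_combination this
  have h4 := congrArg Complex.re h3
  rw [Complex.re_sum, Complex.ofReal_re] at h4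
  rw [← h4]
  refine Finset.sum_congr rfl fun p _ => ?_
  rw [Complex.exp_ofReal_mul_I_re]

lemma int_cos (n : ℤ) :
    ∫ t in (-Real.pi)..Real.pi, Real.cos (n * t) = if n = 0 then 2 * Real.pi else 0 := by
  split_ifs with h
  · subst h; simp; ring
  · have : (n : ℝ) ≠ 0 := by exact_mod_cast h
    rw [intervalIntegral.integral_comp_mul_left (fun x => Real.cos x) this]
    simp [Real.sin_int_mul_pi]

lemma count_eq (k : ℕ) :
    2 * Real.pi * ((Finset.univ.filter fun p : (Fin k → Bool) × (Fin k → Bool) =>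
      wsum p.1 = wsum p.2).card : ℝ) =
    ∫ t in (-Real.pi)..Real.pi, ∏ j ∈ Finset.range k, (2 + 2 * Real.cos (j * t)) := by
  simp_rw [← sum_cos]
  rw [intervalIntegral.integral_finsetSum]
  · simp_rw [int_cos, sub_eq_zero]
    rw [← Finset.sum_filter, Finset.sum_const, nsmul_eq_mul, mul_comm]
    simp
  · intro p _
    apply Continuous.intervalIntegrable
    fun_prop

lemma dirichlet (k : ℕ) (t : ℝ) :
    2 * Real.sin (t / 2) * ∑ j ∈ Finset.range k, Real.cos (j * t) =
      Real.sin (t / 2) + Real.sin ((k - 1 / 2) * t) := by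
  induction k with
  | zero =>
    simp
    rw [show 2⁻¹ * t = t / 2 by ring]; ring
  | succ n ih =>
    rw [Finset.sum_range_succ, mul_add, ih]
    push_cast
    rw [show ((n : ℝ) + 1 - 1 / 2) * t = n * t + t / 2 by ring,
      show ((n : ℝ) - 1 / 2) * t = n * t - t / 2 by ring, Real.sin_add, Real.sin_sub]
    ring

lemma sum_sq_ge (k : ℕ) : ((k : ℝ) ^ 3 - 1) / 12 ≤ ∑ j ∈ Finset.range k, (j : ℝ) ^ 2 := by
  have : ∀ k : ℕ, ∑ j ∈ Finset.range k, (j : ℝ) ^ 2 = (k - 1) * k * (2 * k - 1) / 6 := by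
    intro k
    induction k with
    | zero => simp
    | succ n ih => rw [Finset.sum_range_succ, ih]; push_cast; ring
  rw [this]
  rcases Nat.lt_or_ge k 2 with h | h
  · interval_cases k <;> norm_num
  · have : (2 : ℝ) ≤ k := by exact_mod_cast h
    have h1 : (k : ℝ) ^ 2 * (k - 2) ≥ 0 := by apply mul_nonneg <;> nlinarith
    nlinarith

lemma small_bound (k : ℕ) (t : ℝ) (h0 : 0 ≤ t) (h1 : k * t ≤ Real.pi) :
    2 * t ^ 2 / Real.pi ^ 2 * (((k : ℝ) ^ 3 - 1) / 12) ≤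
      ∑ j ∈ Finset.range k, (1 - Real.cos (j * t)) := by
  refine (mul_le_mul_of_nonneg_left (sum_sq_ge k) (by positivity)).trans ?_
  rw [Finset.mul_sum]
  refine Finset.sum_le_sum fun j hj => ?_
  have hj : (j : ℝ) ≤ k := by exact_mod_cast (Finset.mem_range.1 hj).le
  have hjt : (j : ℝ) * t ≤ k * t := by gcongr
  have hs := Real.mul_le_sin (x := j * t / 2) (by positivity) (by linarith)
  have e : 1 - Real.cos (j * t) = 2 * Real.sin (j * t / 2) ^ 2 := by
    have := Real.cos_sq (j * t / 2)
    have h2 := Real.sin_sq_add_cos_sq (j * t / 2)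
    rw [show 2 * (j * t / 2) = j * t by ring] at this
    linarith
  rw [e]
  have := pow_le_pow_left₀ (by positivity) hs 2
  calc _ = 2 * (2 / Real.pi * (j * t / 2)) ^ 2 := by field_simp
    _ ≤ _ := by linarith

lemma large_bound (k : ℕ) (t : ℝ) (h0 : 0 < t) (h2 : t ≤ Real.pi) (h1 : Real.pi ≤ k * t) :
    ((k : ℝ) - 1) / 2 ≤ ∑ j ∈ Finset.range k, (1 - Real.cos (j * t)) := by
  have hd := dirichlet k t
  have hs := Real.mul_le_sin (x := t / 2) (by positivity) (by linarith)
  have hs' : t / Real.pi ≤ Real.sin (t / 2) := by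
    calc _ = 2 / Real.pi * (t / 2) := by field_simp
      _ ≤ _ := hs
  have hk : 1 ≤ k * Real.sin (t / 2) := by
    calc (1 : ℝ) ≤ k * (t / Real.pi) := by
          rw [← mul_div_assoc, le_div_iff₀ Real.pi_pos]; linarith
      _ ≤ _ := by gcongr
  have hpos : 0 < Real.sin (t / 2) := lt_of_lt_of_le (by positivity) hs'
  have h3 := Real.sin_le_one ((k - 1 / 2) * t)
  rw [Finset.sum_sub_distrib]
  simp only [Finset.sum_const, Finset.card_range, nsmul_eq_mul, mul_one]
  have : ∑ j ∈ Finset.range k, Real.cos (j * t) ≤ (1 + k) / 2 := by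
    by_contra! hc
    nlinarith
  linarith

lemma prod_bound_nonneg (k : ℕ) (hk : 1 ≤ k) (t : ℝ) (h0 : 0 ≤ t) (h2 : t ≤ Real.pi) :
    ∏ j ∈ Finset.range k, ((1 + Real.cos (j * t)) / 2) ≤
      Real.exp 1 * Real.exp (-((k : ℝ) ^ 3 / (12 * Real.pi ^ 2)) * t ^ 2) + Real.exp (-(((k : ℝ) - 1) / 4)) := by
  have hp : ∏ j ∈ Finset.range k, ((1 + Real.cos (j * t)) / 2) ≤
      Real.exp (-(∑ j ∈ Finset.range k, (1 - Real.cos (j * t))) / 2) := by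
    rw [neg_div, Finset.sum_div, ← Finset.sum_neg_distrib, Real.exp_sum]
    refine Finset.prod_le_prod (fun j _ => ?_) (fun j _ => ?_)
    · linarith [Real.neg_one_le_cos (j * t)]
    · have := Real.add_one_le_exp (-((1 - Real.cos (j * t)) / 2))
      linarith
  refine hp.trans ?_
  rcases le_total (k * t) Real.pi with h | h
  · have hb := small_bound k t h0 h
    have : Real.exp (-(∑ j ∈ Finset.range k, (1 - Real.cos (j * t))) / 2) ≤
      Real.exp 1 * Real.exp (-((k : ℝ) ^ 3 / (12 * Real.pi ^ 2)) * t ^ 2) := by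
      rw [← Real.exp_add]
      apply Real.exp_le_exp.2
      have h5 : t ^ 2 / Real.pi ^ 2 ≤ 1 := by
        rw [div_le_one (by positivity)]
        gcongr
      have h6 : (k : ℝ) ^ 3 / (12 * Real.pi ^ 2) * t ^ 2 = (t ^ 2 / Real.pi ^ 2) * k ^ 3 / 12 := by
        field_simp
      rw [neg_mul, h6]
      rw [mul_div_assoc] at hb
      linarith
    linarith [Real.exp_pos (-(((k : ℝ) - 1) / 4))]
  · have ht : 0 < t := by
      rcases h0.lt_or_eq with h' | h'
      · exact h'
      · rw [← h'] at h; linarith [Real.pi_pos]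
    have hb := large_bound k t ht h2 h
    have : Real.exp (-(∑ j ∈ Finset.range k, (1 - Real.cos (j * t))) / 2) ≤
      Real.exp (-(((k : ℝ) - 1) / 4)) := by
      apply Real.exp_le_exp.2
      linarith
    have : 0 ≤ Real.exp 1 * Real.exp (-((k : ℝ) ^ 3 / (12 * Real.pi ^ 2)) * t ^ 2) := by positivity
    linarith

lemma prod_bound (k : ℕ) (hk : 1 ≤ k) (t : ℝ) (h0 : -Real.pi ≤ t) (h2 : t ≤ Real.pi) :
    ∏ j ∈ Finset.range k, ((1 + Real.cos (j * t)) / 2) ≤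
      Real.exp 1 * Real.exp (-((k : ℝ) ^ 3 / (12 * Real.pi ^ 2)) * t ^ 2) + Real.exp (-(((k : ℝ) - 1) / 4)) := by
  rcases le_total 0 t with h | h
  · exact prod_bound_nonneg k hk t h h2
  · have := prod_bound_nonneg k hk (-t) (by linarith) (by linarith)
    simpa using this

lemma prob_le (k : ℕ) (hk : 1 ≤ k) :
    2 * Real.pi * coincideProb k ≤
      Real.exp 1 * √(Real.pi / ((k : ℝ) ^ 3 / (12 * Real.pi ^ 2))) +
        2 * Real.pi * Real.exp (-(((k : ℝ) - 1) / 4)) := by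
  have hk' : (0 : ℝ) < k := by exact_mod_cast hk
  have hc : 0 < (k : ℝ) ^ 3 / (12 * Real.pi ^ 2) := by positivity
  have hg := integrable_exp_neg_mul_sq hc
  have hpi : -Real.pi ≤ Real.pi := by linarith [Real.pi_pos]
  calc 2 * Real.pi * coincideProb k
      ≤ 2 * Real.pi * (((Finset.univ.filter fun p : (Fin k → Bool) × (Fin k → Bool) =>
      wsum p.1 = wsum p.2).card : ℝ) / (2 ^ k * 2 ^ k)) := by
        unfold coincideProb
        gcongr with p
        simp only [wsum_eq]
        intro h
        exact h.2
    _ = ∫ t in (-Real.pi)..Real.pi, ∏ j ∈ Finset.range k, ((1 + Real.cos (j * t)) / 2) := by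
        rw [← mul_div_assoc, count_eq, ← intervalIntegral.integral_div]
        congr 1
        ext t
        rw [← mul_pow, ← Finset.card_range k, ← Finset.prod_const, Finset.card_range,
          ← Finset.prod_div_distrib]
        refine Finset.prod_congr rfl fun j _ => ?_
        ring
    _ ≤ ∫ t in (-Real.pi)..Real.pi, (Real.exp 1 * Real.exp (-((k : ℝ) ^ 3 / (12 * Real.pi ^ 2)) * t ^ 2) + Real.exp (-(((k : ℝ) - 1) / 4))) := by
        apply intervalIntegral.integral_mono_on hpi
        · apply Continuous.intervalIntegrable; fun_prop
        · apply Continuous.intervalIntegrable; fun_prop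
        · intro t ht
          exact prod_bound k hk t ht.1 ht.2
    _ = Real.exp 1 * (∫ t in (-Real.pi)..Real.pi, Real.exp (-((k : ℝ) ^ 3 / (12 * Real.pi ^ 2)) * t ^ 2)) + 2 * Real.pi * Real.exp (-(((k : ℝ) - 1) / 4)) := by
        rw [intervalIntegral.integral_add, intervalIntegral.integral_const_mul,
          intervalIntegral.integral_const, smul_eq_mul]
        · ring
        · apply Continuous.intervalIntegrable; fun_prop
        · apply Continuous.intervalIntegrable; fun_prop
    _ ≤ _ := by
        gcongr
        rw [← integral_gaussian, intervalIntegral.integral_of_le hpi]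
        exact MeasureTheory.setIntegral_le_integral hg (Filter.Eventually.of_forall fun t => (Real.exp_pos _).le)

lemma exp_bound (k : ℕ) (hk : 1 ≤ k) :
    Real.exp (-(((k : ℝ) - 1) / 4)) ≤ Real.exp (1 / 4) * 32 * (k : ℝ) ^ (-(3 : ℝ) / 2) := by
  have hk' : (1 : ℝ) ≤ k := by exact_mod_cast hk
  have h1 : ((k : ℝ) / 4) ^ 2 / 2 ≤ Real.exp (k / 4) := by
    have := Real.quadratic_le_exp_of_nonneg (x := (k : ℝ) / 4) (by positivity)
    linarith [show (0 : ℝ) ≤ (k : ℝ) / 4 by positivity]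
  have h2 : Real.exp (-(k / 4 : ℝ)) ≤ 32 * (k : ℝ) ^ (-2 : ℝ) := by
    rw [Real.exp_neg, Real.rpow_neg (by positivity), Real.rpow_two]
    calc _ ≤ (((k : ℝ) / 4) ^ 2 / 2)⁻¹ := by gcongr
      _ = _ := by field_simp; norm_num
  have h3 : (k : ℝ) ^ (-2 : ℝ) ≤ (k : ℝ) ^ (-(3 : ℝ) / 2) :=
    Real.rpow_le_rpow_of_exponent_le hk' (by norm_num)
  calc _ = Real.exp (1 / 4) * Real.exp (-(k / 4 : ℝ)) := by rw [← Real.exp_add]; ring_nf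
    _ ≤ Real.exp (1 / 4) * (32 * (k : ℝ) ^ (-(3 : ℝ) / 2)) := by gcongr; linarith
    _ = _ := by ring

lemma sqrt_eq (k : ℕ) (hk : 1 ≤ k) :
    √(Real.pi / ((k : ℝ) ^ 3 / (12 * Real.pi ^ 2))) =
      √(12 * Real.pi ^ 3) * (k : ℝ) ^ (-(3 : ℝ) / 2) := by
  have hk' : (0 : ℝ) < k := by exact_mod_cast hk
  rw [show Real.pi / ((k : ℝ) ^ 3 / (12 * Real.pi ^ 2)) = 12 * Real.pi ^ 3 * ((k : ℝ) ^ (-(3 : ℝ))) by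
    rw [Real.rpow_neg hk'.le, show (3 : ℝ) = ((3 : ℕ) : ℝ) by norm_num, Real.rpow_natCast]
    field_simp]
  rw [Real.sqrt_mul (by positivity), Real.sqrt_eq_rpow ((k : ℝ) ^ (-(3 : ℝ))), ← Real.rpow_mul hk'.le]
  norm_num

lemma main_bound : ∃ C > (0 : ℝ), ∀ k : ℕ, 1 ≤ k →
      coincideProb k ≤ C * (k : ℝ) ^ (-(3 : ℝ) / 2) := by
  refine ⟨Real.exp 1 * √(12 * Real.pi ^ 3) / (2 * Real.pi) + Real.exp (1 / 4) * 32, by positivity, ?_⟩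
  intro k hk
  have h := prob_le k hk
  rw [sqrt_eq k hk] at h
  have h2 := exp_bound k hk
  have hpi := Real.pi_pos
  have h3 : 2 * Real.pi * Real.exp (-(((k : ℝ) - 1) / 4)) ≤ 2 * Real.pi * (Real.exp (1 / 4) * 32 * (k : ℝ) ^ (-(3 : ℝ) / 2)) := by gcongr
  have h4 := h.trans (add_le_add_right h3 _)
  refine le_of_mul_le_mul_left (h4.trans_eq ?_) (show 0 < 2 * Real.pi by positivity)
  field_simp

/-- For two independent uniformly random binary sequences there is `C > 0`
with `P[I_k] ≤ C·k^{−3/2}` for all `k ≥ 1`; consequently the expected number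
of `k ≥ 1` for which `I_k` holds, namely `∑_{k ≥ 1} P[I_k]`, is finite. -/
theorem coincide_prob_bound_and_summable :
    (∃ C > (0 : ℝ), ∀ k : ℕ, 1 ≤ k →
      coincideProb k ≤ C * (k : ℝ) ^ (-(3 : ℝ) / 2)) ∧
    Summable fun k : ℕ => coincideProb k := by
  refine ⟨main_bound, ?_⟩
  obtain ⟨C, hC, h⟩ := main_bound
  rw [← summable_nat_add_iff 1]
  have hs : Summable fun k : ℕ => C * (k : ℝ) ^ (-(3 : ℝ) / 2) :=
    (Real.summable_nat_rpow.2 (by norm_num)).mul_left C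
  refine Summable.of_nonneg_of_le (fun k => ?_) (fun k => h (k + 1) (by omega))
    ((summable_nat_add_iff 1).2 hs)
  unfold coincideProb
  positivity
end

section
/- Let N = |{k ≥ 1 : two independent uniform oriented random walks on the Heisenberg Cayley graph coincide at step k}|. Then there exist C > 0 and θ ∈ (0,1) such that P[N ≥ n] ≤ C·θⁿ for all n ≥ 0; i.e., the uniform measure on oriented paths in the Heisenberg Cayley graph has exponential intersection tails. -/
/-- The discrete Heisenberg group realized on ℤ³. -/
structure Heis where
  x : ℤ
  y : ℤ
  z : ℤ
  deriving DecidableEq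

namespace Heis

instance : Mul Heis := ⟨fun p q => ⟨p.x + q.x, p.y + q.y, p.z + q.z + p.x * q.y⟩⟩
instance : One Heis := ⟨⟨0, 0, 0⟩⟩

/-- The generator `a`. -/
def a : Heis := ⟨1, 0, 0⟩

/-- The generator `b`. -/
def b : Heis := ⟨0, 1, 0⟩

/-- The position after `k` steps of the oriented path starting at the
identity and encoded by the binary word `α` (`false` = step by `a`,
`true` = step by `b`). -/
def walk (α : ℕ → Bool) : ℕ → Heis
  | 0 => 1
  | n + 1 => walk α n * (if α n then b else a)

end Heis

/-- Extension of a finite word to an infinite one (by `false`). -/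
def ext {K : ℕ} (α : Fin K → Bool) (j : ℕ) : Bool :=
  if h : j < K then α ⟨j, h⟩ else false


namespace HeisAux

open Finset hiding ext

lemma heis_eq {p q : Heis} (hx : p.x = q.x) (hy : p.y = q.y) (hz : p.z = q.z) : p = q := by
  cases p; cases q; simp_all

lemma mul_x (p q : Heis) : (p * q).x = p.x + q.x := rfl
lemma mul_y (p q : Heis) : (p * q).y = p.y + q.y := rfl
lemma mul_z (p q : Heis) : (p * q).z = p.z + q.z + p.x * q.y := rfl
lemma one_x : (1 : Heis).x = 0 := rfl
lemma one_y : (1 : Heis).y = 0 := rfl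
lemma one_z : (1 : Heis).z = 0 := rfl

lemma hassoc (p q r : Heis) : p * q * r = p * (q * r) := by
  apply heis_eq <;> simp only [mul_x, mul_y, mul_z] <;> ring

lemma hmul_one (p : Heis) : p * 1 = p := by
  apply heis_eq <;> simp [mul_x, mul_y, mul_z, one_x, one_y, one_z]

lemma hcancel {p q r : Heis} : p * q = p * r ↔ q = r := by
  refine ⟨fun h => ?_, fun h => by rw [h]⟩
  have hx := congrArg Heis.x h
  have hy := congrArg Heis.y h
  have hz := congrArg Heis.z h
  simp only [mul_x, mul_y, mul_z] at hx hy hz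
  have hx' : q.x = r.x := by linarith
  have hy' : q.y = r.y := by linarith
  rw [hy'] at hz
  exact heis_eq hx' hy' (by linarith)

lemma walk_add (α : ℕ → Bool) (j m : ℕ) :
    Heis.walk α (j + m) = Heis.walk α j * Heis.walk (fun i => α (j + i)) m := by
  induction m with
  | zero => simp [Heis.walk, hmul_one]
  | succ m ih => rw [← add_assoc, Heis.walk, ih, Heis.walk, hassoc]

lemma walk_congr {α β : ℕ → Bool} (k : ℕ) (h : ∀ i < k, α i = β i) :
    Heis.walk α k = Heis.walk β k := by
  induction k with
  | zero => rfl
  | succ k ih => rw [Heis.walk, Heis.walk, ih (fun i hi => h i (by omega)), h k (by omega)]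

lemma walk_formula (α : ℕ → Bool) (k : ℕ) :
    (Heis.walk α k).x + (Heis.walk α k).y = k ∧
    2 * (Heis.walk α k).z = 2 * (∑ j ∈ range k, if α j then (j : ℤ) else 0)
      - (Heis.walk α k).y * ((Heis.walk α k).y - 1) := by
  induction k with
  | zero => simp [Heis.walk, one_x, one_y, one_z]
  | succ k ih =>
    obtain ⟨h1, h2⟩ := ih
    rw [Heis.walk, sum_range_succ]
    rcases h : α k with _ | _
    · simp only [mul_x, mul_y, mul_z, Heis.a, Bool.false_eq_true, if_false]
      push_cast
      constructor <;> nlinarith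
    · simp only [mul_x, mul_y, mul_z, Heis.b, if_true]
      push_cast
      constructor
      · linarith
      · have : (Heis.walk α k).x = k - (Heis.walk α k).y := by linarith
        rw [this]; nlinarith

lemma walk_eq_imp {α β : ℕ → Bool} {k : ℕ} (h : Heis.walk α k = Heis.walk β k) :
    (∑ j ∈ range k, if α j then (j : ℤ) else 0) = ∑ j ∈ range k, if β j then (j : ℤ) else 0 := by
  have h1 := (walk_formula α k).2
  have h2 := (walk_formula β k).2
  rw [h] at h1
  linarith

/-- weighted sum of a word -/
def V {K : ℕ} (α : Fin K → Bool) : ℤ := ∑ i : Fin K, if α i then (i : ℤ) else 0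

lemma V_eq {K : ℕ} (α : Fin K → Bool) :
    V α = ∑ j ∈ range K, if ext α j then (j : ℤ) else 0 := by
  rw [V, ← Fin.sum_univ_eq_sum_range (fun j => if ext α j then (j : ℤ) else 0)]
  apply sum_congr rfl
  intro i _
  simp [ext]

/-- indicator of coincidence at step k -/
noncomputable def I (α β : ℕ → Bool) (k : ℕ) : ℝ :=
  if Heis.walk α k = Heis.walk β k then 1 else 0

lemma I_nonneg (α β : ℕ → Bool) (k : ℕ) : 0 ≤ I α β k := by
  unfold I; split_ifs <;> norm_num

/-- coincidence count -/
noncomputable def U (K : ℕ) : ℝ := ∑ α : Fin K → Bool, ∑ β : Fin K → Bool, I (ext α) (ext β) K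

/-- exponential moment -/
noncomputable def Phi (ε : ℝ) (K : ℕ) : ℝ :=
  ∑ α : Fin K → Bool, ∑ β : Fin K → Bool, ∏ i ∈ range K, (1 + ε * I (ext α) (ext β) (i + 1))

lemma prod_expand (K : ℕ) : ∀ x : ℕ → ℝ,
    ∏ i ∈ range K, (1 + x i) =
      1 + ∑ j ∈ range K, x j * ∏ i ∈ range (K - 1 - j), (1 + x (j + 1 + i)) := by
  induction K with
  | zero => simp
  | succ K ih =>
    intro x
    rw [prod_range_succ', ih (fun i => x (i + 1)), sum_range_succ']
    have h0 := ih (fun i => x (i + 1))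
    have e1 : ∏ i ∈ range (K + 1 - 1 - 0), (1 + x (0 + 1 + i)) = ∏ i ∈ range K, (1 + x (i + 1)) := by
      apply prod_congr (by simp)
      intro i _
      rw [zero_add, add_comm 1 i]
    rw [e1, h0]
    have e2 : ∀ j ∈ range K, x (j + 1) * ∏ i ∈ range (K - 1 - j), (1 + x (j + 1 + i + 1)) =
        x (j + 1) * ∏ i ∈ range (K + 1 - 1 - (j + 1)), (1 + x (j + 1 + 1 + i)) := by
      intro j _
      congr 1
      apply prod_congr
      · congr 1; omega
      · intro i _
        congr 2; omega
    rw [sum_congr rfl e2]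
    ring

lemma sum_split (j m : ℕ) (f : (Fin (j + m) → Bool) → ℝ) :
    ∑ α, f α = ∑ u : Fin j → Bool, ∑ v : Fin m → Bool, f (Fin.append u v) := by
  rw [← Fintype.sum_prod_type', ← (Fin.appendEquiv j m).sum_comp]
  rfl

lemma ext_append_left {j m : ℕ} (u : Fin j → Bool) (v : Fin m → Bool) (i : ℕ) (hi : i < j) :
    ext (Fin.append u v) i = ext u i := by
  have : i < j + m := by omega
  simp only [ext, hi, this, dif_pos]
  exact Fin.append_left u v ⟨i, hi⟩

lemma ext_append_right {j m : ℕ} (u : Fin j → Bool) (v : Fin m → Bool) (i : ℕ) :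
    ext (Fin.append u v) (j + i) = ext v i := by
  by_cases hi : i < m
  · have : j + i < j + m := by omega
    simp only [ext, hi, this, dif_pos]
    exact Fin.append_right u v ⟨i, hi⟩
  · have : ¬ (j + i < j + m) := by omega
    simp only [ext, hi, this, dif_neg, not_false_eq_true]

lemma walk_append_left {j m : ℕ} (u : Fin j → Bool) (v : Fin m → Bool) :
    Heis.walk (ext (Fin.append u v)) j = Heis.walk (ext u) j :=
  walk_congr j (fun i hi => ext_append_left u v i hi)

lemma walk_append_right {j m : ℕ} (u : Fin j → Bool) (v : Fin m → Bool) (k : ℕ) :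
    Heis.walk (ext (Fin.append u v)) (j + k) = Heis.walk (ext u) j * Heis.walk (ext v) k := by
  rw [walk_add, walk_append_left]
  congr 1
  exact walk_congr k (fun i _ => ext_append_right u v i)

lemma markov_step (ε : ℝ) (j m : ℕ) :
    ∑ α : Fin (j + m) → Bool, ∑ β : Fin (j + m) → Bool,
      I (ext α) (ext β) j * ∏ i ∈ range m, (1 + ε * I (ext α) (ext β) (j + i + 1))
      = U j * Phi ε m := by
  have key : ∀ (u u' : Fin j → Bool) (v v' : Fin m → Bool),
      I (ext (Fin.append u v)) (ext (Fin.append u' v')) j *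
        ∏ i ∈ range m, (1 + ε * I (ext (Fin.append u v)) (ext (Fin.append u' v')) (j + i + 1))
      = I (ext u) (ext u') j * ∏ i ∈ range m, (1 + ε * I (ext v) (ext v') (i + 1)) := by
    intro u u' v v'
    simp only [I, walk_append_left, add_assoc, walk_append_right]
    by_cases h : Heis.walk (ext u) j = Heis.walk (ext u') j
    · simp only [h, hcancel]
    · simp [h]
  rw [sum_split]
  simp_rw [sum_split j m (fun β => I (ext _) (ext β) j * _), key]
  unfold U Phi
  rw [sum_mul]
  apply sum_congr rfl
  intro u _
  rw [sum_comm, sum_mul]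
  apply sum_congr rfl
  intro u' _
  simp_rw [mul_sum]

lemma Phi_rec (ε : ℝ) (K : ℕ) :
    Phi ε K = 4 ^ K + ∑ j ∈ range K, ε * (U (j + 1) * Phi ε (K - 1 - j)) := by
  have h1 : Phi ε K = ∑ α : Fin K → Bool, ∑ β : Fin K → Bool, (1 + ∑ j ∈ range K,
      (ε * I (ext α) (ext β) (j + 1)) *
        ∏ i ∈ range (K - 1 - j), (1 + ε * I (ext α) (ext β) (j + 1 + i + 1))) := by
    unfold Phi
    apply sum_congr rfl
    intro α _
    apply sum_congr rfl
    intro β _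
    exact prod_expand K (fun i => ε * I (ext α) (ext β) (i + 1))
  rw [h1]
  simp_rw [sum_add_distrib]
  congr 1
  · simp [← mul_pow]; norm_num
  · simp_rw [sum_comm (t := range K)]
    apply sum_congr rfl
    intro j hj
    obtain ⟨m, rfl⟩ : ∃ m, K = (j + 1) + m := ⟨K - (j + 1), by have := mem_range.1 hj; omega⟩
    have hm : j + 1 + m - 1 - j = m := by omega
    rw [hm, ← markov_step, mul_sum]
    simp_rw [mul_sum, mul_assoc]

lemma Phi_le (ε G : ℝ) (hε : 0 ≤ ε) (hG : ∀ K, ∑ j ∈ range K, U (j + 1) / 4 ^ (j + 1) ≤ G)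
    (h : ε * G ≤ 1 / 2) (K : ℕ) : Phi ε K ≤ 2 * 4 ^ K := by
  have hU : ∀ j, 0 ≤ U j := fun j => sum_nonneg fun _ _ => sum_nonneg fun _ _ => I_nonneg _ _ _
  induction K using Nat.strong_induction_on with
  | _ K ih =>
    rw [Phi_rec]
    have : ∑ j ∈ range K, ε * (U (j + 1) * Phi ε (K - 1 - j)) ≤
        ∑ j ∈ range K, ε * (2 * 4 ^ K) * (U (j + 1) / 4 ^ (j + 1)) := by
      apply sum_le_sum
      intro j hj
      have hj := mem_range.1 hj
      have e : (4 : ℝ) ^ K = 4 ^ (K - 1 - j) * 4 ^ (j + 1) := by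
        rw [← pow_add]; congr 1; omega
      have h2 := ih (K - 1 - j) (by omega)
      have : ε * (2 * 4 ^ K) * (U (j + 1) / 4 ^ (j + 1)) =
          ε * (U (j + 1) * (2 * 4 ^ (K - 1 - j))) := by
        rw [e]; field_simp
      rw [this]
      exact mul_le_mul_of_nonneg_left (mul_le_mul_of_nonneg_left h2 (hU _)) hε
    rw [← mul_sum (a := ε * (2 * 4 ^ K))] at this
    have h3 : ε * (2 * 4 ^ K) * ∑ j ∈ range K, U (j + 1) / 4 ^ (j + 1) ≤ ε * (2 * 4 ^ K) * G :=
      mul_le_mul_of_nonneg_left (hG K) (by positivity)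
    have h4 : (0 : ℝ) < 4 ^ K := by positivity
    nlinarith

/-- Fourier sum -/
noncomputable def g (K : ℕ) (t : ℝ) : ℝ :=
  ∑ α : Fin K → Bool, ∑ β : Fin K → Bool, Real.cos (2 * Real.pi * ((V α - V β : ℤ) : ℝ) * t)

lemma g_eq_normSq (K : ℕ) (t : ℝ) :
    g K t = Complex.normSq (∑ α : Fin K → Bool, Complex.exp ((2 * Real.pi * V α * t : ℝ) * Complex.I)) := by
  rw [Complex.normSq_apply, Complex.re_sum, Complex.im_sum]
  simp_rw [Complex.exp_ofReal_mul_I_re, Complex.exp_ofReal_mul_I_im, sum_mul_sum, ← sum_add_distrib,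
    ← Real.cos_sub]
  unfold g
  apply sum_congr rfl; intro α _
  apply sum_congr rfl; intro β _
  congr 1; push_cast; ring

lemma exp_sum (K : ℕ) (t : ℝ) :
    (∑ α : Fin K → Bool, Complex.exp ((2 * Real.pi * V α * t : ℝ) * Complex.I)) =
    ∏ i ∈ range K, (1 + Complex.exp ((2 * (Real.pi * i * t) : ℝ) * Complex.I)) := by
  rw [← Fin.prod_univ_eq_prod_range (fun i : ℕ => (1 + Complex.exp ((2 * (Real.pi * i * t) : ℝ) * Complex.I)))]
  have : ∀ i : Fin K, (1 + Complex.exp ((2 * (Real.pi * (i : ℕ) * t) : ℝ) * Complex.I)) =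
      ∑ c : Bool, Complex.exp ((2 * (Real.pi * (if c then ((i : ℕ) : ℤ) else 0 : ℤ) * t) : ℝ) * Complex.I) := by
    intro i; simp [add_comm]
  simp_rw [this]
  rw [Fintype.prod_sum]
  apply sum_congr rfl; intro α _
  rw [← Complex.exp_sum, V]
  congr 1
  rw [← sum_mul]
  congr 1
  push_cast
  simp only [mul_sum, sum_mul]
  apply sum_congr rfl; intro i _; ring

lemma g_nonneg (K : ℕ) (t : ℝ) : 0 ≤ g K t := by
  rw [g_eq_normSq]; exact Complex.normSq_nonneg _

lemma factor_le (θ : ℝ) : Complex.normSq (1 + Complex.exp ((2 * θ : ℝ) * Complex.I)) ≤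
    4 * Real.exp (-(Real.sin θ) ^ 2) := by
  rw [Complex.normSq_apply, Complex.add_re, Complex.add_im, Complex.exp_ofReal_mul_I_re,
    Complex.exp_ofReal_mul_I_im, Complex.one_re, Complex.one_im]
  have h1 := Real.sin_sq_add_cos_sq (2 * θ)
  have h2 := Real.cos_two_mul θ
  have h3 := Real.sin_sq_add_cos_sq θ
  have h4 := Real.add_one_le_exp (-(Real.sin θ) ^ 2)
  nlinarith

lemma g_le (K : ℕ) (t : ℝ) :
    g K t ≤ 4 ^ K * Real.exp (-∑ j ∈ range K, (Real.sin (Real.pi * j * t)) ^ 2) := by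
  rw [g_eq_normSq, exp_sum, map_prod, ← sum_neg_distrib, Real.exp_sum]
  calc _ ≤ ∏ j ∈ range K, 4 * Real.exp (-(Real.sin (Real.pi * j * t)) ^ 2) :=
        prod_le_prod (fun _ _ => Complex.normSq_nonneg _) (fun j _ => factor_le _)
    _ = _ := by rw [prod_mul_distrib]; simp

lemma g_le' (K : ℕ) (t : ℝ) : g K t ≤ 4 ^ K := by
  refine (g_le K t).trans ?_
  have : Real.exp (-∑ j ∈ range K, (Real.sin (Real.pi * j * t)) ^ 2) ≤ 1 := by
    rw [Real.exp_le_one_iff, neg_nonpos]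
    exact sum_nonneg fun _ _ => sq_nonneg _
  have h4 : (0 : ℝ) < 4 ^ K := by positivity
  nlinarith

lemma g_cont (K : ℕ) : Continuous (g K) := by
  unfold g; fun_prop

lemma g_even (K : ℕ) (t : ℝ) : g K (-t) = g K t := by
  unfold g; simp

lemma int_cos (n : ℤ) (hn : n ≠ 0) :
    ∫ t in (0 : ℝ)..1/2, Real.cos (2 * Real.pi * (n : ℝ) * t) = 0 := by
  have hc : 2 * Real.pi * (n : ℝ) ≠ 0 := by
    have := Real.pi_ne_zero
    have : (n : ℝ) ≠ 0 := by exact_mod_cast hn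
    positivity
  rw [intervalIntegral.integral_comp_mul_left (fun x => Real.cos x) hc, integral_cos]
  have : 2 * Real.pi * (n : ℝ) * (1 / 2) = n * Real.pi := by ring
  rw [this, Real.sin_int_mul_pi]; simp

lemma I_le_int {K : ℕ} (α β : Fin K → Bool) : I (ext α) (ext β) K ≤
    2 * ∫ t in (0 : ℝ)..1/2, Real.cos (2 * Real.pi * ((V α - V β : ℤ) : ℝ) * t) := by
  by_cases hV : V α - V β = 0
  · rw [hV]; simp [I]; split_ifs <;> norm_num
  · rw [int_cos _ hV]
    have : ¬ (Heis.walk (ext α) K = Heis.walk (ext β) K) := by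
      intro h
      apply hV
      rw [V_eq, V_eq, walk_eq_imp h, sub_self]
    simp [I, this]

lemma U_le_int (K : ℕ) : U K ≤ 2 * ∫ t in (0 : ℝ)..1/2, g K t := by
  unfold g U
  rw [intervalIntegral.integral_finsetSum]
  · rw [mul_sum]
    apply sum_le_sum; intro α _
    rw [intervalIntegral.integral_finsetSum]
    · rw [mul_sum]
      apply sum_le_sum; intro β _
      exact I_le_int α β
    · intro β _
      exact Continuous.intervalIntegrable (by fun_prop) _ _
  · intro α _
    exact Continuous.intervalIntegrable (by fun_prop) _ _

lemma sin_sub_sq (A B : ℝ) : Real.sin (A - B) ^ 2 ≤ 2 * (Real.sin A ^ 2 + Real.sin B ^ 2) := by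
  rw [Real.sin_sub]
  have h1 := Real.sin_sq_add_cos_sq A
  have h2 := Real.sin_sq_add_cos_sq B
  have h3 : (Real.sin A * Real.cos B) ^ 2 ≤ Real.sin A ^ 2 := by
    rw [mul_pow]; nlinarith [sq_nonneg (Real.sin A), sq_nonneg (Real.sin B), mul_nonneg (sq_nonneg (Real.sin A)) (sq_nonneg (Real.sin B))]
  have h4 : (Real.cos A * Real.sin B) ^ 2 ≤ Real.sin B ^ 2 := by
    rw [mul_pow]; nlinarith [sq_nonneg (Real.sin A), sq_nonneg (Real.sin B), mul_nonneg (sq_nonneg (Real.sin A)) (sq_nonneg (Real.sin B))]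
  nlinarith [sq_nonneg (Real.sin A * Real.cos B + Real.cos A * Real.sin B)]

lemma S_lower (d m : ℕ) (t : ℝ) :
    m * Real.sin (Real.pi * d * t) ^ 2 ≤
      4 * ∑ j ∈ range (d + m), (Real.sin (Real.pi * j * t)) ^ 2 := by
  have h1 : ∑ j ∈ range m, Real.sin (Real.pi * (d + j : ℕ) * t) ^ 2 ≤
      ∑ j ∈ range (d + m), (Real.sin (Real.pi * j * t)) ^ 2 := by
    rw [sum_range_add]
    have : 0 ≤ ∑ j ∈ range d, (Real.sin (Real.pi * j * t)) ^ 2 := sum_nonneg fun _ _ => sq_nonneg _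
    linarith
  have h2 : ∑ j ∈ range m, Real.sin (Real.pi * j * t) ^ 2 ≤
      ∑ j ∈ range (d + m), (Real.sin (Real.pi * j * t)) ^ 2 :=
    sum_le_sum_of_subset_of_nonneg (range_mono (by omega)) fun _ _ _ => sq_nonneg _
  have h3 : ∑ j ∈ range m, Real.sin (Real.pi * d * t) ^ 2 ≤
      ∑ j ∈ range m, 2 * (Real.sin (Real.pi * (d + j : ℕ) * t) ^ 2 + Real.sin (Real.pi * j * t) ^ 2) := by
    apply sum_le_sum; intro j _
    have := sin_sub_sq (Real.pi * (d + j : ℕ) * t) (Real.pi * j * t)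
    have e : Real.pi * (d + j : ℕ) * t - Real.pi * j * t = Real.pi * d * t := by push_cast; ring
    rwa [e] at this
  rw [← mul_sum, sum_add_distrib] at h3
  simp only [sum_const, card_range, nsmul_eq_mul] at h3
  linarith

lemma choose_d (K : ℕ) (hK : 2 ≤ K) (s t : ℝ) (hs : 0 < s) (hs1 : s ≤ 1) (ht : s / K ≤ t)
    (ht2 : t ≤ 1 / 2) : ∃ d : ℕ, 2 * d ≤ K ∧ (d : ℝ) * t ≤ 1 / 2 ∧ s / 4 ≤ d * t := by
  have hK0 : (0 : ℝ) < K := by positivity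
  have ht0 : 0 < t := lt_of_lt_of_le (by positivity) ht
  by_cases h : t ≤ 1 / K
  · have hd1 : 2 * (K / 2) ≤ K := by omega
    have hd1' : 2 * ((K / 2 : ℕ) : ℝ) ≤ K := by exact_mod_cast hd1
    have hd2 : K ≤ 4 * (K / 2) := by omega
    have hd2' : (K : ℝ) ≤ 4 * ((K / 2 : ℕ) : ℝ) := by exact_mod_cast hd2
    have h' : t * K ≤ 1 := by rwa [le_div_iff₀ hK0] at h
    have ht' : s ≤ t * K := by rwa [div_le_iff₀ hK0] at ht
    refine ⟨K / 2, hd1, ?_, ?_⟩ <;> nlinarith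
  · push Not at h
    rw [div_lt_iff₀ hK0] at h
    have hy : 1 ≤ 1 / (2 * t) := by rw [le_div_iff₀ (by positivity)]; linarith
    have hf1 := Nat.floor_le (show 0 ≤ 1 / (2 * t) by positivity)
    have hf2 := Nat.lt_floor_add_one (1 / (2 * t))
    have hf3 : 1 ≤ ⌊1 / (2 * t)⌋₊ := Nat.one_le_floor_iff _ |>.2 hy
    have hf3' : (1 : ℝ) ≤ ⌊1 / (2 * t)⌋₊ := by exact_mod_cast hf3
    rw [le_div_iff₀ (by positivity)] at hf1
    rw [div_lt_iff₀ (by positivity)] at hf2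
    refine ⟨⌊1 / (2 * t)⌋₊, ?_, ?_, ?_⟩
    · have : 2 * (⌊1 / (2 * t)⌋₊ : ℝ) ≤ K := by
        by_contra hc
        push Not at hc
        nlinarith
      exact_mod_cast this
    · nlinarith
    · nlinarith

lemma g_small (K : ℕ) (hK : 2 ≤ K) (s t : ℝ) (hs : 0 < s) (hs1 : s ≤ 1) (ht : s / K ≤ t)
    (ht2 : t ≤ 1 / 2) : g K t ≤ 4 ^ K * Real.exp (-(K * s ^ 2 / 32)) := by
  obtain ⟨d, h1, h2, h3⟩ := choose_d K hK s t hs hs1 ht ht2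
  refine (g_le K t).trans ?_
  gcongr
  obtain ⟨m, rfl⟩ : ∃ m, K = d + m := ⟨K - d, by omega⟩
  have hS := S_lower d m t
  have hpi := Real.pi_pos
  have hsin := Real.mul_le_sin (x := Real.pi * d * t) (by rw [mul_assoc]; apply mul_nonneg hpi.le; linarith)
    (by nlinarith)
  have e : 2 / Real.pi * (Real.pi * d * t) = 2 * (d * t) := by field_simp
  rw [e] at hsin
  have hsq : s ^ 2 / 4 ≤ Real.sin (Real.pi * d * t) ^ 2 := by nlinarith
  have hm : ((d + m : ℕ) : ℝ) ≤ 2 * m := by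
    have : d + m ≤ 2 * m := by omega
    exact_mod_cast this
  have hm0 : (0 : ℝ) ≤ m := by positivity
  nlinarith [mul_le_mul_of_nonneg_left hsq hm0, mul_le_mul_of_nonneg_right hm (sq_nonneg s)]

lemma U_le_one (K : ℕ) : U K ≤ 4 ^ K := by
  unfold U
  calc _ ≤ ∑ α : Fin K → Bool, ∑ β : Fin K → Bool, (1 : ℝ) := by
        apply sum_le_sum; intro α _
        apply sum_le_sum; intro β _
        unfold I; split_ifs <;> norm_num
    _ = _ := by simp [← mul_pow]; norm_num

lemma U_bound_s (K : ℕ) (hK : 2 ≤ K) (s : ℝ) (hs : 0 < s) (hs1 : s ≤ 1) :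
    U K ≤ 4 ^ K * (2 * (s / K) + Real.exp (-(K * s ^ 2 / 32))) := by
  have hK0 : (0 : ℝ) < K := by positivity
  have hK2 : (2 : ℝ) ≤ K := by exact_mod_cast hK
  have hr0 : 0 ≤ s / K := by positivity
  have hr : s / K ≤ 1 / 2 := by rw [div_le_iff₀ hK0]; linarith
  have hI := U_le_int K
  have hii : ∀ a b : ℝ, IntervalIntegrable (g K) MeasureTheory.volume a b :=
    fun a b => (g_cont K).intervalIntegrable a b
  rw [← intervalIntegral.integral_add_adjacent_intervals (hii 0 (s / K)) (hii (s / K) (1 / 2))] at hI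
  have h1 : ∫ t in (0 : ℝ)..(s / K), g K t ≤ ∫ t in (0 : ℝ)..(s / K), (4 : ℝ) ^ K :=
    intervalIntegral.integral_mono_on hr0 (hii _ _) (by simp) fun t _ => g_le' K t
  have h2 : ∫ t in (s / K)..(1 / 2), g K t ≤
      ∫ t in (s / K)..(1 / 2), 4 ^ K * Real.exp (-(K * s ^ 2 / 32)) :=
    intervalIntegral.integral_mono_on hr (hii _ _) (by simp) fun t ht =>
      g_small K hK s t hs hs1 ht.1 ht.2
  rw [intervalIntegral.integral_const, smul_eq_mul] at h1 h2
  have h5 : 0 < 4 ^ K * Real.exp (-(K * s ^ 2 / 32)) := by positivity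
  nlinarith

lemma U_bound (K : ℕ) (hK : 1 ≤ K) :
    U K / 4 ^ K ≤ 2 * (K : ℝ) ^ (-(5 / 4) : ℝ) + 24 * 32 ^ 4 * (K : ℝ) ^ (-2 : ℝ) := by
  rw [div_le_iff₀ (by positivity)]
  rcases Nat.lt_or_ge K 2 with h | h
  · obtain rfl : K = 1 := by omega
    have := U_le_one 1
    norm_num at this ⊢
    linarith
  · have hK0 : (0 : ℝ) < K := by positivity
    have hK1 : (1 : ℝ) ≤ K := by exact_mod_cast hK
    set s : ℝ := (K : ℝ) ^ (-(1 / 4) : ℝ) with hs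
    have hs0 : 0 < s := Real.rpow_pos_of_pos hK0 _
    have hs1 : s ≤ 1 := Real.rpow_le_one_of_one_le_of_nonpos hK1 (by norm_num)
    have hb := U_bound_s K h s hs0 hs1
    have e1 : s / K = (K : ℝ) ^ (-(5 / 4) : ℝ) := by
      rw [hs, show (-(5 / 4) : ℝ) = -(1 / 4) - 1 by norm_num, Real.rpow_sub_one hK0.ne']
    have e2 : s ^ 4 = (K : ℝ)⁻¹ := by
      rw [hs, ← Real.rpow_natCast, ← Real.rpow_mul hK0.le, ← Real.rpow_neg_one]
      norm_num
    have e3 : (K : ℝ) ^ (-2 : ℝ) = ((K : ℝ) ^ 2)⁻¹ := by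
      rw [Real.rpow_neg hK0.le]; norm_cast
    have e4 : Real.exp (-(K * s ^ 2 / 32)) ≤ 24 * 32 ^ 4 * (K : ℝ) ^ (-2 : ℝ) := by
      have hx : 0 < K * s ^ 2 / 32 := by positivity
      have := Real.pow_div_factorial_le_exp (K * s ^ 2 / 32) hx.le 4
      have e5 : (K * s ^ 2 / 32) ^ 4 = (K : ℝ) ^ 2 / 32 ^ 4 := by
        have : (K * s ^ 2 / 32) ^ 4 = K ^ 4 * (s ^ 4) ^ 2 / 32 ^ 4 := by ring
        rw [this, e2]; field_simp
      rw [e5] at this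
      rw [Real.exp_neg, e3]
      calc _ ≤ ((K : ℝ) ^ 2 / 32 ^ 4 / (Nat.factorial 4 : ℕ))⁻¹ := by
            apply inv_anti₀ _ this
            positivity
        _ = _ := by
            rw [show Nat.factorial 4 = 24 by rfl]
            push_cast
            field_simp
    rw [e1] at hb
    refine hb.trans ?_
    rw [mul_comm]
    gcongr

lemma exists_G : ∃ G : ℝ, 0 < G ∧ ∀ K, ∑ j ∈ range K, U (j + 1) / 4 ^ (j + 1) ≤ G := by
  let b : ℕ → ℝ := fun K => 2 * (K : ℝ) ^ (-(5 / 4) : ℝ) + 24 * 32 ^ 4 * (K : ℝ) ^ (-2 : ℝ)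
  have hb : Summable b := by
    apply Summable.add
    · exact (Real.summable_nat_rpow.2 (by norm_num)).mul_left _
    · exact (Real.summable_nat_rpow.2 (by norm_num)).mul_left _
  have hb0 : ∀ n, 0 ≤ b n := fun n => by positivity
  have hb' : Summable (fun n => b (n + 1)) := (summable_nat_add_iff 1).2 hb
  refine ⟨∑' n, b (n + 1) + 1, ?_, fun K => ?_⟩
  · have : 0 ≤ ∑' n, b (n + 1) := tsum_nonneg fun n => hb0 _
    linarith
  · calc _ ≤ ∑ j ∈ range K, b (j + 1) := sum_le_sum fun j _ => U_bound (j + 1) (by omega)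
      _ ≤ ∑' n, b (n + 1) := hb'.sum_le_tsum _ fun n _ => hb0 _
      _ ≤ _ := by linarith

lemma prod_eq_pow (ε : ℝ) (K : ℕ) (α β : ℕ → Bool) :
    ∏ i ∈ range K, (1 + ε * I α β (i + 1)) =
      (1 + ε) ^ ((Finset.Icc 1 K).filter fun k => Heis.walk α k = Heis.walk β k).card := by
  have h : ∏ i ∈ range K, (1 + ε * I α β (i + 1)) = ∏ k ∈ Finset.Icc 1 K, (1 + ε * I α β k) := by
    rw [range_eq_Ico, prod_Ico_add' (fun k => 1 + ε * I α β k) 0 K 1]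
    rfl
  rw [h, ← prod_const, prod_filter]
  apply prod_congr rfl
  intro k _
  unfold I
  split_ifs <;> simp

end HeisAux

/-- Exponential intersection tails for the uniform measure on oriented paths
in the Heisenberg Cayley graph: with `N` the number of steps `k ≥ 1` at which
two independent uniform oriented random walks coincide, there are `C > 0` and
`θ ∈ (0,1)` with `P[N ≥ n] ≤ C·θⁿ` for all `n ≥ 0`.

The event `N ≥ n` is the increasing union over horizons `K` of the cylinder
events "at least `n` coincidences occur at steps `1 ≤ k ≤ K`", each of which
depends only on the first `K` letters of each word; so `P[N ≥ n] ≤ C·θⁿ`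
is equivalent to the corresponding bound, uniform in `K`, for these cylinder
events under the uniform measure on pairs of words in `{0,1}^K`. -/
theorem heisenberg_EIT :
    ∃ C > (0 : ℝ), ∃ θ : ℝ, 0 < θ ∧ θ < 1 ∧ ∀ n K : ℕ,
      (((Finset.univ.filter fun p : (Fin K → Bool) × (Fin K → Bool) =>
          n ≤ ((Finset.Icc 1 K).filter fun k =>
            Heis.walk (ext p.1) k = Heis.walk (ext p.2) k).card).card : ℝ)
        / (2 ^ K * 2 ^ K)) ≤ C * θ ^ n := by
  obtain ⟨G, hG0, hG⟩ := HeisAux.exists_G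
  set ε : ℝ := 1 / (2 * G) with hε
  have hε0 : 0 < ε := by positivity
  refine ⟨2, by norm_num, (1 + ε)⁻¹, by positivity, inv_lt_one_of_one_lt₀ (by linarith), ?_⟩
  intro n K
  have hP := HeisAux.Phi_le ε G hε0.le hG (by rw [hε]; field_simp; norm_num) K
  have h4 : (2 : ℝ) ^ K * 2 ^ K = 4 ^ K := by rw [← mul_pow]; norm_num
  rw [h4, div_le_iff₀ (by positivity), inv_pow]
  have hpow : (0 : ℝ) < (1 + ε) ^ n := by positivity
  suffices h : (((Finset.univ.filter fun p : (Fin K → Bool) × (Fin K → Bool) =>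
          n ≤ ((Finset.Icc 1 K).filter fun k =>
            Heis.walk (ext p.1) k = Heis.walk (ext p.2) k).card).card : ℝ)) * (1 + ε) ^ n
        ≤ HeisAux.Phi ε K by
    have h' := h.trans hP
    rw [← le_div_iff₀ hpow] at h'
    refine h'.trans (le_of_eq ?_)
    field_simp
  unfold HeisAux.Phi
  simp_rw [HeisAux.prod_eq_pow]
  rw [← Fintype.sum_prod_type']
  rw [← nsmul_eq_mul, ← Finset.sum_const, Finset.sum_filter]
  apply Finset.sum_le_sum
  intro p _
  split_ifs with hp
  · exact pow_le_pow_right₀ (by linarith) hp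
  · positivity
end
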